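/- arXiv:1403.7939 — 2 statements merged into one kernel-verified Lean document; each statement's English description precedes it below -/
import Mathlib

section
/- Let a, b, c, d be natural numbers and suppose there exist a finite set P of points and a finite set L of lines in the real projective plane such that exactly a points of P have degree 3, exactly b points of P have degree 4, every point of P has degree 3 or 4, exactly c lines of L have degree 3, exactly d lines of L have degree 4, and every line of L has degree 3 or 4. Then there exists a geometric (m_4) configuration with m = 16a + 16b + 4c. -/
/- Model of the real projective plane: a point is a 1-dimensional linear subspace
of ℝ³ and a line is a 2-dimensional linear subspace of ℝ³; a point p is incident
to a line ℓ when p ≤ ℓ. -/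

open scoped Classical

/-- The degree of a point `p` with respect to a finite set `L` of lines:
the number of lines of `L` incident to `p`. -/
noncomputable def pointDeg (L : Finset (Submodule ℝ (Fin 3 → ℝ)))
    (p : Submodule ℝ (Fin 3 → ℝ)) : ℕ :=
  (L.filter fun l => p ≤ l).card

/-- The degree of a line `l` with respect to a finite set `P` of points:
the number of points of `P` incident to `l`. -/
noncomputable def lineDeg (P : Finset (Submodule ℝ (Fin 3 → ℝ)))
    (l : Submodule ℝ (Fin 3 → ℝ)) : ℕ :=
  (P.filter fun p => p ≤ l).card

/-- The number of incidences of `(P, L)`: the number of pairs `(p, ℓ) ∈ P × L`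
with `p` incident to `ℓ`. -/
noncomputable def incCount (P L : Finset (Submodule ℝ (Fin 3 → ℝ))) : ℕ :=
  ((P ×ˢ L).filter fun pl => pl.1 ≤ pl.2).card

/-- A point of the real projective plane: a 1-dimensional linear subspace of ℝ³. -/
def IsProjPoint (p : Submodule ℝ (Fin 3 → ℝ)) : Prop := Module.finrank ℝ p = 1

/-- A line of the real projective plane: a 2-dimensional linear subspace of ℝ³. -/
def IsProjLine (l : Submodule ℝ (Fin 3 → ℝ)) : Prop := Module.finrank ℝ l = 2

section

open Matrix

/-- The vectors `v i` and the covectors `w j` represent points and lines of the projective plane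
whose incidence relation is `R`. -/
def Realizes {I J : Type} (R : I → J → Prop) (v : I → Fin 3 → ℝ) (w : J → Fin 3 → ℝ) : Prop :=
  (∀ i, v i ≠ 0) ∧ (∀ j, w j ≠ 0) ∧ ∀ i j, w j ⬝ᵥ v i = 0 ↔ R i j

/-- `n` disjoint copies of an incidence relation. -/
def copies {I J : Type} (n : ℕ) (R : I → J → Prop) : Fin n × I → Fin n × J → Prop :=
  fun x y => x.1 = y.1 ∧ R x.2 y.2

/-- The incidence relation of an affine replication: `n` copies of `R`, a new line through the
copies of each point in `S`, and a new point on the copies of each line in `T`. -/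
def replication {I J : Type} (n : ℕ) (R : I → J → Prop) (S : I → Prop) (T : J → Prop) :
    (Fin n × I) ⊕ {j // T j} → (Fin n × J) ⊕ {i // S i} → Prop
  | .inl x, .inl y => copies n R x y
  | .inl x, .inr i => x.2 = i
  | .inr j, .inl y => y.2 = j
  | .inr _, .inr _ => False

/-- The image of the vector `v` under the homology with centre `c` and axis `α`. -/
def dilate (α c : Fin 3 → ℝ) (s : ℝ) (v : Fin 3 → ℝ) : Fin 3 → ℝ := v + (s * (α ⬝ᵥ v)) • c

/-- The image of the line with covector `w` under the homology with centre `c` and axis `α`. -/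
def codilate (α c : Fin 3 → ℝ) (s : ℝ) (w : Fin 3 → ℝ) : Fin 3 → ℝ :=
  (1 + s * (α ⬝ᵥ c)) • w - (s * (w ⬝ᵥ c)) • α

theorem codilate_dotProduct_dilate (α c v w : Fin 3 → ℝ) (s t : ℝ) :
    codilate α c t w ⬝ᵥ dilate α c s v =
      (1 + t * (α ⬝ᵥ c)) * (w ⬝ᵥ v) + (s - t) * (α ⬝ᵥ v) * (w ⬝ᵥ c) := by
  simp only [codilate, dilate, dotProduct_add, sub_dotProduct, smul_dotProduct, dotProduct_smul,
    smul_eq_mul]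
  ring

theorem dotProduct_dilate_axis (α c v : Fin 3 → ℝ) (s : ℝ) :
    α ⬝ᵥ dilate α c s v = (1 + s * (α ⬝ᵥ c)) * (α ⬝ᵥ v) := by
  simp only [dilate, dotProduct_add, dotProduct_smul, smul_eq_mul]
  ring

theorem codilate_dotProduct_center (α c w : Fin 3 → ℝ) (s : ℝ) :
    codilate α c s w ⬝ᵥ c = w ⬝ᵥ c := by
  simp only [codilate, sub_dotProduct, smul_dotProduct, smul_eq_mul]
  ring

theorem exists_forall_add_mul_ne_zero {K : Type} [Finite K] (f g : K → ℝ)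
    (h : ∀ k, f k = 0 → g k ≠ 0) : ∃ e : ℝ, ∀ k, f k + e * g k ≠ 0 := by
  obtain ⟨e, he⟩ := (Set.finite_range fun k => -f k / g k).exists_notMem
  refine ⟨e, fun k hk => ?_⟩
  by_cases hg : g k = 0
  · exact h k (by simpa [hg] using hk) hg
  · exact he ⟨k, by field_simp; linarith⟩

theorem exists_forall_dotProduct_ne_zero {K : Type} [Finite K] (u : K → Fin 3 → ℝ)
    (h : ∀ k, u k ≠ 0) : ∃ x : Fin 3 → ℝ, ∀ k, u k ⬝ᵥ x ≠ 0 := by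
  obtain ⟨e, he⟩ := exists_forall_add_mul_ne_zero
    (fun k : {k // u k 0 = 0 → u k 1 ≠ 0} => u k 0) (fun k => u k 1) fun k => k.2
  obtain ⟨d, hd⟩ := exists_forall_add_mul_ne_zero (fun k => u k 0 + e * u k 1) (fun k => u k 2) <| by
    intro k hk h2
    by_cases h01 : u k 0 = 0 → u k 1 ≠ 0
    · exact he ⟨k, h01⟩ hk
    · push Not at h01
      apply h k
      ext i
      fin_cases i <;> simp [h01, h2]
  refine ⟨![1, e, d], fun k hk => hd k ?_⟩
  simp only [dotProduct, Fin.sum_univ_three, Matrix.cons_val] at hk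
  linarith

/-- Generic homologies with a given centre and axis produce disjoint copies with no unintended
incidences. -/
theorem exists_dilations {I J : Type} [Finite I] [Finite J] (n : ℕ) {R : I → J → Prop}
    {v : I → Fin 3 → ℝ} {w : J → Fin 3 → ℝ} (hR : ∀ i j, w j ⬝ᵥ v i = 0 ↔ R i j)
    {α c : Fin 3 → ℝ} (hc : ∀ j, w j ⬝ᵥ c ≠ 0) (hα : ∀ i, α ⬝ᵥ v i ≠ 0) :
    ∃ s : Fin n → ℝ, (∀ k, 1 + s k * (α ⬝ᵥ c) ≠ 0) ∧
      ∀ x y, codilate α c (s y.1) (w y.2) ⬝ᵥ dilate α c (s x.1) (v x.2) = 0 ↔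
        copies n R x y := by
  obtain ⟨e, he⟩ := exists_forall_add_mul_ne_zero
    (Sum.elim (fun _ : Fin n => (1 : ℝ))
      (fun z : {z : (Fin n × I) × (Fin n × J) // z.1.1 ≠ z.2.1} => w z.1.2.2 ⬝ᵥ v z.1.1.2))
    (Sum.elim (fun k : Fin n => (k : ℝ) * (α ⬝ᵥ c))
      (fun z => (z.1.2.1 : ℝ) * (α ⬝ᵥ c) * (w z.1.2.2 ⬝ᵥ v z.1.1.2) +
        ((z.1.1.1 : ℝ) - (z.1.2.1 : ℝ)) * (α ⬝ᵥ v z.1.1.2) * (w z.1.2.2 ⬝ᵥ c))) <| by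
    rintro (k | ⟨⟨⟨k, i⟩, ⟨m, j⟩⟩, hz⟩) h0
    · simp at h0
    · simp only [Sum.elim_inr] at h0 hz ⊢
      rw [h0, mul_zero, zero_add]
      refine mul_ne_zero (mul_ne_zero ?_ (hα i)) (hc j)
      rw [sub_ne_zero]
      exact_mod_cast fun h => hz (Fin.ext h)
  have h1 : ∀ k : Fin n, 1 + e * k * (α ⬝ᵥ c) ≠ 0 := fun k => by
    simpa [mul_assoc] using he (.inl k)
  refine ⟨fun k => e * k, h1, ?_⟩
  rintro ⟨k, i⟩ ⟨m, j⟩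
  rw [codilate_dotProduct_dilate]
  simp only [copies]
  by_cases hkm : k = m
  · subst hkm
    simp [h1, hR]
  · simp only [hkm, false_and, iff_false]
    have := he (.inr ⟨⟨⟨k, i⟩, ⟨m, j⟩⟩, hkm⟩)
    simp only [Sum.elim_inr] at this
    exact fun h0 => this (by linear_combination h0)

theorem ne_zero_of_dotProduct_ne_zero {x y : Fin 3 → ℝ} (h : x ⬝ᵥ y ≠ 0) : y ≠ 0 := by
  rintro rfl
  simp at h

theorem exists_realizes_copies {I J : Type} [Finite I] [Finite J] (n : ℕ) {R : I → J → Prop}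
    {v : I → Fin 3 → ℝ} {w : J → Fin 3 → ℝ} (h : Realizes R v w) :
    ∃ v' w', Realizes (copies n R) v' w' := by
  obtain ⟨hv, hw, hR⟩ := h
  obtain ⟨c, hc⟩ := exists_forall_dotProduct_ne_zero w hw
  obtain ⟨α, hα⟩ := exists_forall_dotProduct_ne_zero v hv
  have hα' : ∀ i, α ⬝ᵥ v i ≠ 0 := fun i => by rw [dotProduct_comm]; exact hα i
  obtain ⟨s, hs, hinc⟩ := exists_dilations n hR hc hα'
  refine ⟨_, _, fun x => ?_, fun y => ?_, hinc⟩
  · apply ne_zero_of_dotProduct_ne_zero (x := α)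
    rw [dotProduct_dilate_axis]
    exact mul_ne_zero (hs _) (hα' _)
  · apply ne_zero_of_dotProduct_ne_zero (x := c)
    rw [dotProduct_comm, codilate_dotProduct_center]
    exact hc _

theorem cross_ne_zero_of_dotProduct {x y z : Fin 3 → ℝ} (hx : z ⬝ᵥ x ≠ 0) (hy : z ⬝ᵥ y = 0)
    (hy0 : y ≠ 0) : x ⨯₃ y ≠ 0 := by
  intro h
  have h1 := cross_cross_eq_smul_sub_smul x y z
  rw [h, dotProduct_comm x z, dotProduct_comm y z, hy, zero_smul, sub_zero,
    LinearMap.map_zero₂] at h1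
  exact smul_ne_zero hx hy0 h1.symm

theorem exists_realizes_replication {I J : Type} [Finite I] [Finite J] (n : ℕ)
    {R : I → J → Prop} (S : I → Prop) (T : J → Prop)
    {v : I → Fin 3 → ℝ} {w : J → Fin 3 → ℝ} (h : Realizes R v w)
    (hI : ∀ i, ∃ j, R i j) (hJ : ∀ j, ∃ i, R i j)
    (hvv : ∀ i i', i ≠ i' → v i ⨯₃ v i' ≠ 0) (hww : ∀ j j', j ≠ j' → w j ⨯₃ w j' ≠ 0) :
    ∃ v' w', Realizes (replication n R S T) v' w' := by
  obtain ⟨hv, hw, hR⟩ := h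
  obtain ⟨c, hc⟩ := exists_forall_dotProduct_ne_zero
    (Sum.elim w fun z : {z : I × I // z.1 ≠ z.2} => v z.1.1 ⨯₃ v z.1.2) <| by
      rintro (j | z)
      exacts [hw j, hvv _ _ z.2]
  have hcw : ∀ j, w j ⬝ᵥ c ≠ 0 := fun j => hc (.inl j)
  have hcv : ∀ i i', i ≠ i' → v i ⨯₃ v i' ⬝ᵥ c ≠ 0 := fun i i' hi => hc (.inr ⟨(i, i'), hi⟩)
  have hx : ∀ i j, (w j ⬝ᵥ c) • v i - (w j ⬝ᵥ v i) • c ≠ 0 := by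
    intro i j h0
    obtain ⟨j', hj'⟩ := hI i
    have h1 := congrArg (w j' ⬝ᵥ ·) h0
    simp only [dotProduct_sub, dotProduct_smul, (hR _ _).2 hj', smul_eq_mul, mul_zero, zero_sub,
      dotProduct_zero, neg_eq_zero, mul_eq_zero, hcw, or_false] at h1
    simp [h1, hcw, hv] at h0
  obtain ⟨α, hα⟩ := exists_forall_dotProduct_ne_zero
    (Sum.elim v (Sum.elim (fun z : {z : J × J // z.1 ≠ z.2} => w z.1.1 ⨯₃ w z.1.2)
      fun z : I × J => (w z.2 ⬝ᵥ c) • v z.1 - (w z.2 ⬝ᵥ v z.1) • c)) <| by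
      rintro (i | z | z)
      exacts [hv i, hww _ _ z.2, hx _ _]
  have hαv : ∀ i, α ⬝ᵥ v i ≠ 0 := fun i => by rw [dotProduct_comm]; exact hα (.inl i)
  have hαw : ∀ j j', j ≠ j' → w j ⨯₃ w j' ⬝ᵥ α ≠ 0 :=
    fun j j' hj => hα (.inr (.inl ⟨(j, j'), hj⟩))
  have hαx : ∀ i j, ((w j ⬝ᵥ c) • v i - (w j ⬝ᵥ v i) • c) ⬝ᵥ α ≠ 0 :=
    fun i j => hα (.inr (.inr (i, j)))
  obtain ⟨s, hs, hinc⟩ := exists_dilations n hR hcw hαv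
  refine ⟨Sum.elim (fun x => dilate α c (s x.1) (v x.2)) fun j => α ⨯₃ w j,
    Sum.elim (fun y => codilate α c (s y.1) (w y.2)) fun i => c ⨯₃ v i, ?_, ?_, ?_⟩
  · rintro (x | j)
    · apply ne_zero_of_dotProduct_ne_zero (x := α)
      rw [Sum.elim_inl, dotProduct_dilate_axis]
      exact mul_ne_zero (hs _) (hαv _)
    · obtain ⟨i, hi⟩ := hJ j
      apply cross_ne_zero_of_dotProduct (z := v i) _ _ (hw j)
      · rw [dotProduct_comm]; exact hαv i
      · rw [dotProduct_comm]; exact (hR _ _).2 hi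
  · rintro (y | i)
    · apply ne_zero_of_dotProduct_ne_zero (x := c)
      rw [Sum.elim_inl, dotProduct_comm, codilate_dotProduct_center]
      exact hcw _
    · obtain ⟨j, hj⟩ := hI i
      exact cross_ne_zero_of_dotProduct (hcw j) ((hR _ _).2 hj) (hv i)
  · rintro (x | j) (y | i)
    · exact hinc x y
    · have key : (c ⨯₃ v i) ⬝ᵥ dilate α c (s x.1) (v x.2) = v i ⨯₃ v x.2 ⬝ᵥ c := by
        simp [dilate, cross_apply, dotProduct, Fin.sum_univ_three]
        ring
      simp only [Sum.elim_inl, Sum.elim_inr, key, replication]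
      by_cases hi : x.2 = i
      · simp [hi]
      · simp [hi, hcv _ _ (Ne.symm hi)]
    · have key : codilate α c (s y.1) (w y.2) ⬝ᵥ (α ⨯₃ w j) =
          (1 + s y.1 * (α ⬝ᵥ c)) * (w j ⨯₃ w y.2 ⬝ᵥ α) := by
        simp [codilate, cross_apply, dotProduct, Fin.sum_univ_three]
        ring
      simp only [Sum.elim_inl, Sum.elim_inr, key, replication, mul_eq_zero, hs, false_or]
      by_cases hj : y.2 = j
      · simp [hj]
      · simp [hj, hαw _ _ (Ne.symm hj)]
    · have key : (c ⨯₃ v i) ⬝ᵥ (α ⨯₃ w j) =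
          -(((w j ⬝ᵥ c) • v i - (w j ⬝ᵥ v i) • c) ⬝ᵥ α) := by
        simp [cross_apply, dotProduct, Fin.sum_univ_three]
        ring
      simp only [Sum.elim_inr, key, replication, neg_eq_zero, hαx]

/-- Points with the same lines coincide, and lines with the same points coincide. -/
def TwinFree {I J : Type} (R : I → J → Prop) : Prop :=
  (∀ i i', (∀ j, R i j ↔ R i' j) → i = i') ∧ ∀ j j', (∀ i, R i j ↔ R i j') → j = j'

theorem cross_ne_zero_of_twinFree {I J : Type} {R : I → J → Prop}
    {v : I → Fin 3 → ℝ} {w : J → Fin 3 → ℝ} (h : Realizes R v w) (hR : TwinFree R) :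
    (∀ i i', i ≠ i' → v i ⨯₃ v i' ≠ 0) ∧ ∀ j j', j ≠ j' → w j ⨯₃ w j' ≠ 0 := by
  obtain ⟨hv, hw, hr⟩ := h
  constructor
  · intro i i' hi h0
    refine hi (hR.1 _ _ fun j => ?_)
    rw [← hr, ← hr]
    constructor <;> intro hj <;> by_contra hj'
    · apply cross_ne_zero_of_dotProduct hj' hj (hv i)
      rw [← cross_anticomm, h0, neg_zero]
    · exact cross_ne_zero_of_dotProduct hj' hj (hv i') h0
  · intro j j' hj h0
    refine hj (hR.2 _ _ fun i => ?_)
    rw [← hr, ← hr, dotProduct_comm, dotProduct_comm (w j')]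
    constructor <;> intro hi <;> by_contra hi'
    · apply cross_ne_zero_of_dotProduct hi' hi (hw j)
      rw [← cross_anticomm, h0, neg_zero]
    · exact cross_ne_zero_of_dotProduct hi' hi (hw j') h0

theorem TwinFree.copies {I J : Type} {R : I → J → Prop} (hR : TwinFree R)
    (hI : ∀ i, ∃ j, R i j) (hJ : ∀ j, ∃ i, R i j) (n : ℕ) : TwinFree (copies n R) := by
  constructor
  · rintro ⟨k, i⟩ ⟨k', i'⟩ h
    obtain ⟨j, hj⟩ := hI i
    obtain rfl : k' = k := ((h (k, j)).1 ⟨rfl, hj⟩).1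
    obtain rfl : i = i' := hR.1 _ _ fun j => by simpa [_root_.copies] using h (k', j)
    rfl
  · rintro ⟨k, j⟩ ⟨k', j'⟩ h
    obtain ⟨i, hi⟩ := hJ j
    obtain rfl : k = k' := ((h (k, i)).1 ⟨rfl, hi⟩).1
    obtain rfl : j = j' := hR.2 _ _ fun i => by simpa [_root_.copies] using h (k, i)
    rfl

theorem TwinFree.replication {I J : Type} {R : I → J → Prop} (hR : TwinFree R)
    (hI : ∀ i, ∃ j, R i j) (hJ : ∀ j, ∃ i, R i j) {n : ℕ} (hn : 2 ≤ n) (S : I → Prop)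
    (T : J → Prop) : TwinFree (replication n R S T) := by
  have hc := hR.copies hI hJ n
  have : NeZero n := ⟨by omega⟩
  have : Nontrivial (Fin n) := Fin.nontrivial_iff_two_le.2 hn
  constructor
  · rintro (x | j) (x' | j') h
    · rw [hc.1 x x' fun y => h (.inl y)]
    · obtain ⟨k, hk⟩ := exists_ne x.1
      exact absurd ((h (.inl (k, j'))).2 rfl).1 hk.symm
    · obtain ⟨k, hk⟩ := exists_ne x'.1
      exact absurd ((h (.inl (k, j))).1 rfl).1 hk.symm
    · rw [Subtype.ext ((h (.inl (0, j))).1 rfl)]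
  · rintro (y | i) (y' | i') h
    · rw [hc.2 y y' fun x => h (.inl x)]
    · obtain ⟨k, hk⟩ := exists_ne y.1
      exact absurd ((h (.inl (k, i'))).2 rfl).1 hk
    · obtain ⟨k, hk⟩ := exists_ne y'.1
      exact absurd ((h (.inl (k, i))).1 rfl).1 hk
    · rw [Subtype.ext ((h (.inl (0, i))).1 rfl)]

/-- Every point lies on exactly four lines, and every line contains exactly four points. -/
def FourRegular {I J : Type} [Fintype I] [Fintype J] (R : I → J → Prop) : Prop :=
  (∀ i, (Finset.univ.filter fun j => R i j).card = 4) ∧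
    ∀ j, (Finset.univ.filter fun i => R i j).card = 4

theorem FourRegular.exists_rel {I J : Type} [Fintype I] [Fintype J] {R : I → J → Prop}
    (h : FourRegular R) : (∀ i, ∃ j, R i j) ∧ ∀ j, ∃ i, R i j := by
  constructor
  · intro i
    obtain ⟨j, hj⟩ := Finset.card_pos.1 (by rw [h.1 i]; norm_num)
    exact ⟨j, (Finset.mem_filter.1 hj).2⟩
  · intro j
    obtain ⟨i, hi⟩ := Finset.card_pos.1 (by rw [h.2 j]; norm_num)
    exact ⟨i, (Finset.mem_filter.1 hi).2⟩

theorem FourRegular.card_eq {I J : Type} [Fintype I] [Fintype J] {R : I → J → Prop}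
    (h : FourRegular R) : Fintype.card I = Fintype.card J := by
  have := Finset.card_mul_eq_card_mul R (s := Finset.univ) (t := Finset.univ)
    (fun i _ => h.1 i) (fun j _ => h.2 j)
  simpa using this

theorem card_filter_sum {A B : Type} [Fintype A] [Fintype B] (p : A ⊕ B → Prop) :
    (Finset.univ.filter p).card = (Finset.univ.filter fun x => p (.inl x)).card +
      (Finset.univ.filter fun x => p (.inr x)).card := by
  simp only [Finset.card_filter, Fintype.sum_sum_type]

theorem card_filter_of_iff_fst {A B : Type} [Fintype A] [Fintype B] {p : A × B → Prop} (a : A)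
    {q : B → Prop} (h : ∀ x, p x ↔ a = x.1 ∧ q x.2) :
    (Finset.univ.filter p).card = (Finset.univ.filter q).card := by
  rw [← Finset.card_image_of_injective (Finset.univ.filter q) (Prod.mk_right_injective a)]
  refine congrArg Finset.card (Finset.ext fun ⟨x, y⟩ => ?_)
  simp only [Finset.mem_filter, Finset.mem_univ, true_and, Finset.mem_image, h, Prod.mk.injEq]
  aesop

theorem card_filter_of_iff_snd {A B : Type} [Fintype A] [Fintype B] {p : A × B → Prop} (b : B)
    (h : ∀ x, p x ↔ x.2 = b) : (Finset.univ.filter p).card = Fintype.card A := by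
  rw [← Finset.card_univ, ← Finset.card_image_of_injective Finset.univ (Prod.mk_left_injective b)]
  refine congrArg Finset.card (Finset.ext fun ⟨x, y⟩ => ?_)
  simp only [Finset.mem_filter, Finset.mem_univ, true_and, Finset.mem_image, h, Prod.mk.injEq]
  aesop

theorem card_filter_of_forall_not {A : Type} [Fintype A] {p : A → Prop} (h : ∀ x, ¬p x) :
    (Finset.univ.filter p).card = 0 :=
  Finset.card_eq_zero.2 (Finset.filter_eq_empty_iff.2 fun x _ => h x)

theorem card_filter_of_iff_eq_coe {A : Type} {p : A → Prop} [Fintype {x // p x}] (a : A)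
    {q : {x // p x} → Prop} (h : ∀ x, q x ↔ x.1 = a) :
    (Finset.univ.filter q).card = if p a then 1 else 0 := by
  split_ifs with ha
  · rw [Finset.card_eq_one]
    refine ⟨⟨a, ha⟩, ?_⟩
    ext x
    simp [h, Subtype.ext_iff]
  · rw [Finset.card_eq_zero, Finset.filter_eq_empty_iff]
    rintro x - hx
    exact ha ((h x).1 hx ▸ x.2)

theorem FourRegular.copies {I J : Type} [Fintype I] [Fintype J] {R : I → J → Prop}
    (h : FourRegular R) (n : ℕ) : FourRegular (copies n R) := by
  constructor
  · rintro ⟨k, i⟩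
    rw [← h.1 i]
    exact card_filter_of_iff_fst k fun _ => Iff.rfl
  · rintro ⟨k, j⟩
    rw [← h.2 j]
    exact card_filter_of_iff_fst k fun _ => and_congr_left fun _ => eq_comm

theorem fourRegular_replication {I J : Type} [Fintype I] [Fintype J] {R : I → J → Prop}
    {S : I → Prop} {T : J → Prop}
    (hI : ∀ i, (Finset.univ.filter fun j => R i j).card = if S i then 3 else 4)
    (hJ : ∀ j, (Finset.univ.filter fun i => R i j).card = if T j then 3 else 4) :
    FourRegular (replication 4 R S T) := by
  constructor
  · rintro (⟨k, i⟩ | j) <;> rw [card_filter_sum]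
    · refine (congrArg₂ (· + ·) (card_filter_of_iff_fst k (q := R i) fun _ => Iff.rfl)
        (card_filter_of_iff_eq_coe i fun _ => eq_comm)).trans ?_
      rw [hI]
      split_ifs <;> rfl
    · refine (congrArg₂ (· + ·) (card_filter_of_iff_snd (A := Fin 4) j.1 fun _ => Iff.rfl)
        (card_filter_of_forall_not fun _ h => h)).trans ?_
      simp
  · rintro (⟨k, j⟩ | i) <;> rw [card_filter_sum]
    · refine (congrArg₂ (· + ·) (card_filter_of_iff_fst k (q := fun i => R i j) fun _ =>
        and_congr_left fun _ => eq_comm) (card_filter_of_iff_eq_coe j fun _ => eq_comm)).trans ?_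
      rw [hJ]
      split_ifs <;> rfl
    · refine (congrArg₂ (· + ·) (card_filter_of_iff_snd (A := Fin 4) i.1 fun _ => Iff.rfl)
        (card_filter_of_forall_not fun _ h => h)).trans ?_
      simp

theorem IsProjPoint.exists_le_iff {p : Submodule ℝ (Fin 3 → ℝ)} (hp : IsProjPoint p) :
    ∃ v ≠ 0, ∀ l : Submodule ℝ (Fin 3 → ℝ), p ≤ l ↔ v ∈ l := by
  obtain ⟨v, hv, h⟩ := finrank_eq_one_iff'.1 hp
  refine ⟨v, by simpa using hv, fun l => ⟨fun hl => hl v.2, fun hl x hx => ?_⟩⟩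
  obtain ⟨r, hr⟩ := h ⟨x, hx⟩
  have : r • (v : Fin 3 → ℝ) = x := congrArg Subtype.val hr
  exact this ▸ l.smul_mem r hl

theorem isProjLine_ker {f : Module.Dual ℝ (Fin 3 → ℝ)} (hf : f ≠ 0) :
    IsProjLine (LinearMap.ker f) := by
  have := Module.Dual.finrank_ker_add_one_of_ne_zero hf
  rw [Module.finrank_fin_fun] at this
  exact Nat.succ_injective this

theorem IsProjLine.exists_mem_iff {l : Submodule ℝ (Fin 3 → ℝ)} (hl : IsProjLine l) :
    ∃ w ≠ 0, ∀ x, x ∈ l ↔ w ⬝ᵥ x = 0 := by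
  have hlt : l < ⊤ := by
    rw [lt_top_iff_ne_top]
    rintro rfl
    simp [IsProjLine] at hl
  obtain ⟨f, hf, hle⟩ := l.exists_le_ker_of_lt_top hlt
  obtain ⟨w, rfl⟩ := (dotProductEquiv ℝ (Fin 3)).surjective f
  have heq := Submodule.eq_of_le_of_finrank_eq hle (hl.trans (isProjLine_ker hf).symm)
  refine ⟨w, by simpa using hf, fun x => ?_⟩
  rw [heq]
  simp

theorem IsProjLine.eq_sup {p q l : Submodule ℝ (Fin 3 → ℝ)} (hl : IsProjLine l)
    (hp : IsProjPoint p) (hq : IsProjPoint q) (hpq : p ≠ q) (hpl : p ≤ l) (hql : q ≤ l) :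
    l = p ⊔ q := by
  refine (Submodule.eq_of_le_of_finrank_le (sup_le hpl hql) ?_).symm
  have hlt : p < p ⊔ q := by
    refine lt_of_le_of_ne le_sup_left fun h => hpq ?_
    have hqp : q ≤ p := h ▸ le_sup_right
    exact (Submodule.eq_of_le_of_finrank_eq hqp (hq.trans hp.symm)).symm
  have := Submodule.finrank_lt_finrank_of_lt hlt
  simp only [IsProjLine, IsProjPoint] at hl hp
  omega

theorem card_filter_subtype_mem {α : Type} (A : Finset α) (q : α → Prop) :
    (Finset.univ.filter fun x : {x // x ∈ A} => q x).card = (A.filter q).card := by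
  rw [Finset.card_filter, Finset.card_filter]
  exact Finset.sum_coe_sort A fun x => if q x then 1 else 0

theorem twinFree_le {P L : Finset (Submodule ℝ (Fin 3 → ℝ))} (hP : ∀ p ∈ P, IsProjPoint p)
    (hL : ∀ l ∈ L, IsProjLine l) (hPL : ∀ p ∈ P, 1 < pointDeg L p)
    (hLP : ∀ l ∈ L, 1 < lineDeg P l) :
    TwinFree fun (p : {p // p ∈ P}) (l : {l // l ∈ L}) => p.1 ≤ l.1 := by
  constructor
  · rintro ⟨p, hp⟩ ⟨q, hq⟩ h
    obtain ⟨l, hl, l', hl', hne⟩ := Finset.one_lt_card.1 (hPL p hp)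
    rw [Finset.mem_filter] at hl hl'
    by_contra hpq
    have hpq' : p ≠ q := fun h => hpq (Subtype.ext h)
    apply hne
    rw [(hL l hl.1).eq_sup (hP p hp) (hP q hq) hpq' hl.2 ((h ⟨l, hl.1⟩).1 hl.2),
      (hL l' hl'.1).eq_sup (hP p hp) (hP q hq) hpq' hl'.2 ((h ⟨l', hl'.1⟩).1 hl'.2)]
  · rintro ⟨l, hl⟩ ⟨l', hl'⟩ h
    obtain ⟨p, hp, q, hq, hne⟩ := Finset.one_lt_card.1 (hLP l hl)
    rw [Finset.mem_filter] at hp hq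
    exact Subtype.ext (((hL l hl).eq_sup (hP p hp.1) (hP q hq.1) hne hp.2 hq.2).trans
      ((hL l' hl').eq_sup (hP p hp.1) (hP q hq.1) hne ((h ⟨p, hp.1⟩).1 hp.2)
        ((h ⟨q, hq.1⟩).1 hq.2)).symm)

theorem exists_realizes_le {P L : Finset (Submodule ℝ (Fin 3 → ℝ))}
    (hP : ∀ p ∈ P, IsProjPoint p) (hL : ∀ l ∈ L, IsProjLine l) :
    ∃ v w, Realizes (fun (p : {p // p ∈ P}) (l : {l // l ∈ L}) => p.1 ≤ l.1) v w := by
  choose v hv hv' using fun p : {p // p ∈ P} => (hP p.1 p.2).exists_le_iff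
  choose w hw hw' using fun l : {l // l ∈ L} => (hL l.1 l.2).exists_mem_iff
  exact ⟨v, w, hv, hw, fun p l => ((hv' p l).trans (hw' l _)).symm⟩

/-- A twin-free realizable 4-regular incidence relation gives a geometric configuration. -/
theorem exists_configuration {I J : Type} [Fintype I] [Fintype J] {R : I → J → Prop}
    (hR : TwinFree R) (h4 : FourRegular R) {v : I → Fin 3 → ℝ} {w : J → Fin 3 → ℝ}
    (h : Realizes R v w) :
    ∃ P L : Finset (Submodule ℝ (Fin 3 → ℝ)),
      (∀ p ∈ P, IsProjPoint p) ∧ (∀ l ∈ L, IsProjLine l) ∧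
      P.card = Fintype.card I ∧ L.card = Fintype.card J ∧
      (∀ p ∈ P, pointDeg L p = 4) ∧ (∀ l ∈ L, lineDeg P l = 4) := by
  obtain ⟨hv, hw, hr⟩ := h
  set p : I → Submodule ℝ (Fin 3 → ℝ) := fun i => ℝ ∙ v i with hp
  set l : J → Submodule ℝ (Fin 3 → ℝ) :=
    fun j => LinearMap.ker (dotProductEquiv ℝ (Fin 3) (w j)) with hl
  have hpl : ∀ i j, p i ≤ l j ↔ R i j := fun i j => by
    rw [← hr, hp, hl, Submodule.span_singleton_le_iff_mem]
    simp
  have hpi : Function.Injective p := fun i i' hi => hR.1 i i' fun j => by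
    rw [← hpl, ← hpl, hi]
  have hli : Function.Injective l := fun j j' hj => hR.2 j j' fun i => by
    rw [← hpl, ← hpl, hj]
  refine ⟨Finset.univ.image p, Finset.univ.image l, ?_, ?_, ?_, ?_, ?_, ?_⟩
  · simp only [Finset.mem_image, Finset.mem_univ, true_and, forall_exists_index,
      forall_apply_eq_imp_iff]
    exact fun i => finrank_span_singleton (hv i)
  · simp only [Finset.mem_image, Finset.mem_univ, true_and, forall_exists_index,
      forall_apply_eq_imp_iff]
    exact fun j => isProjLine_ker (by simpa using hw j)
  · rw [Finset.card_image_of_injective _ hpi, Finset.card_univ]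
  · rw [Finset.card_image_of_injective _ hli, Finset.card_univ]
  · simp only [Finset.mem_image, Finset.mem_univ, true_and, forall_exists_index,
      forall_apply_eq_imp_iff]
    intro i
    rw [pointDeg, Finset.filter_image, Finset.card_image_of_injective _ hli, ← h4.1 i]
    simp only [hpl]
  · simp only [Finset.mem_image, Finset.mem_univ, true_and, forall_exists_index,
      forall_apply_eq_imp_iff]
    intro j
    rw [lineDeg, Finset.filter_image, Finset.card_image_of_injective _ hpi, ← h4.2 j]
    simp only [hpl]

theorem exists_configuration_of_three_four {I J : Type} [Fintype I] [Fintype J]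
    {R : I → J → Prop} (hR : TwinFree R) {S : I → Prop} {T : J → Prop}
    (hI : ∀ i, (Finset.univ.filter fun j => R i j).card = if S i then 3 else 4)
    (hJ : ∀ j, (Finset.univ.filter fun i => R i j).card = if T j then 3 else 4)
    {v : I → Fin 3 → ℝ} {w : J → Fin 3 → ℝ} (h : Realizes R v w) :
    ∃ P L : Finset (Submodule ℝ (Fin 3 → ℝ)),
      (∀ p ∈ P, IsProjPoint p) ∧ (∀ l ∈ L, IsProjLine l) ∧
      P.card = 16 * Fintype.card I + 4 * (Finset.univ.filter T).card ∧ L.card = P.card ∧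
      (∀ p ∈ P, pointDeg L p = 4) ∧ (∀ l ∈ L, lineDeg P l = 4) := by
  have hI' : ∀ i, ∃ j, R i j := fun i => by
    obtain ⟨j, hj⟩ := Finset.card_pos.1 (by rw [hI i]; split_ifs <;> norm_num)
    exact ⟨j, (Finset.mem_filter.1 hj).2⟩
  have hJ' : ∀ j, ∃ i, R i j := fun j => by
    obtain ⟨i, hi⟩ := Finset.card_pos.1 (by rw [hJ j]; split_ifs <;> norm_num)
    exact ⟨i, (Finset.mem_filter.1 hi).2⟩
  obtain ⟨hvv, hww⟩ := cross_ne_zero_of_twinFree h hR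
  obtain ⟨v', w', h'⟩ := exists_realizes_replication 4 S T h hI' hJ' hvv hww
  obtain ⟨v'', w'', h''⟩ := exists_realizes_copies 4 h'
  have h4 := fourRegular_replication hI hJ
  have h4' := h4.copies 4
  have hR' := (hR.replication hI' hJ' (by norm_num) S T).copies h4.exists_rel.1 h4.exists_rel.2 4
  obtain ⟨P, L, hP, hL, hcP, hcL, hPL, hLP⟩ := exists_configuration hR' h4' h''
  refine ⟨P, L, hP, hL, ?_, by rw [hcP, hcL, h4'.card_eq], hPL, hLP⟩
  rw [hcP, Fintype.card_prod, Fintype.card_sum, Fintype.card_prod, Fintype.card_fin,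
    Fintype.card_subtype]
  ring

theorem card_filter_add_card_filter {α : Type} {A : Finset α} {f : α → ℕ}
    (h : ∀ x ∈ A, f x = 3 ∨ f x = 4) :
    (A.filter fun x => f x = 3).card + (A.filter fun x => f x = 4).card = A.card := by
  rw [← Finset.card_filter_add_card_filter_not (s := A) fun x => f x = 3]
  congr 2
  refine Finset.filter_congr fun x hx => ?_
  have := h x hx
  omega

end

theorem stmt10 (a b c d : ℕ)
    (h : ∃ P L : Finset (Submodule ℝ (Fin 3 → ℝ)),
      (∀ p ∈ P, IsProjPoint p) ∧ (∀ l ∈ L, IsProjLine l) ∧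
      (P.filter fun p => pointDeg L p = 3).card = a ∧
      (P.filter fun p => pointDeg L p = 4).card = b ∧
      (∀ p ∈ P, pointDeg L p = 3 ∨ pointDeg L p = 4) ∧
      (L.filter fun l => lineDeg P l = 3).card = c ∧
      (L.filter fun l => lineDeg P l = 4).card = d ∧
      (∀ l ∈ L, lineDeg P l = 3 ∨ lineDeg P l = 4)) :
    ∃ P' L' : Finset (Submodule ℝ (Fin 3 → ℝ)),
      (∀ p ∈ P', IsProjPoint p) ∧ (∀ l ∈ L', IsProjLine l) ∧
      P'.card = 16 * a + 16 * b + 4 * c ∧ L'.card = 16 * a + 16 * b + 4 * c ∧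
      (∀ p ∈ P', pointDeg L' p = 4) ∧ (∀ l ∈ L', lineDeg P' l = 4) := by
  obtain ⟨P, L, hP, hL, ha, hb, hPL, hc, -, hLP⟩ := h
  have hR := twinFree_le hP hL (fun p hp => by have := hPL p hp; omega)
    fun l hl => by have := hLP l hl; omega
  obtain ⟨v, w, hvw⟩ := exists_realizes_le hP hL
  obtain ⟨P', L', hP', hL', hcP, hcL, hPL', hLP'⟩ := exists_configuration_of_three_four hR
    (S := fun p => pointDeg L p.1 = 3) (T := fun l => lineDeg P l.1 = 3)
    (fun i => (card_filter_subtype_mem L fun l => i.1 ≤ l).trans (by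
      split_ifs with hi
      exacts [hi, (hPL i.1 i.2).resolve_left hi]))
    (fun j => (card_filter_subtype_mem P fun p => p ≤ j.1).trans (by
      split_ifs with hj
      exacts [hj, (hLP j.1 j.2).resolve_left hj])) hvw
  have hab := card_filter_add_card_filter hPL
  have hm : P'.card = 16 * a + 16 * b + 4 * c := by
    rw [hcP, Fintype.card_coe, ← hab, ha, hb, ← hc, mul_add]
    congr 2
    convert card_filter_subtype_mem L fun l => lineDeg P l = 3
  exact ⟨P', L', hP', hL', hm, hcL.trans hm, hPL', hLP'⟩
end

section
/- There exists a geometric (16_{3|4}) configuration with exactly 60 incidences, i.e., a set P of 16 points and a set L of 16 lines in the real projective plane such that every point of P has degree 3 or 4, every line of L has degree 3 or 4, and the number of incidences of (P, L) is 60. -/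
/- Model of the real projective plane: a point is a 1-dimensional linear subspace
of ℝ³ and a line is a 2-dimensional linear subspace of ℝ³; a point p is incident
to a line ℓ when p ≤ ℓ. -/

open scoped Classical

/-- The subspace of `ℝ³` spanned by an integer vector. -/
noncomputable def intPoint (v : Fin 3 → ℤ) : Submodule ℝ (Fin 3 → ℝ) :=
  Submodule.span ℝ {fun k => (v k : ℝ)}

/-- The linear functional on `ℝ³` given by the dot product with an integer vector. -/
noncomputable def intFunctional (w : Fin 3 → ℤ) : Module.Dual ℝ (Fin 3 → ℝ) :=
  dotProductBilin ℝ ℝ fun k => (w k : ℝ)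

/-- The subspace of `ℝ³` orthogonal to an integer vector. -/
noncomputable def intLine (w : Fin 3 → ℤ) : Submodule ℝ (Fin 3 → ℝ) :=
  LinearMap.ker (intFunctional w)

lemma intFunctional_apply (w v : Fin 3 → ℤ) :
    intFunctional w (fun k => (v k : ℝ)) = ((w ⬝ᵥ v : ℤ) : ℝ) := by
  simp [intFunctional, dotProduct]

lemma intPoint_le_intLine_iff (v w : Fin 3 → ℤ) : intPoint v ≤ intLine w ↔ w ⬝ᵥ v = 0 := by
  rw [intPoint, Submodule.span_singleton_le_iff_mem, intLine, LinearMap.mem_ker,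
    intFunctional_apply, Int.cast_eq_zero]

lemma isProjPoint_intPoint {v : Fin 3 → ℤ} (hv : v ≠ 0) : IsProjPoint (intPoint v) := by
  refine finrank_span_singleton fun h => hv (funext fun k => ?_)
  simpa using congrFun h k

lemma isProjLine_intLine {w : Fin 3 → ℤ} (hw : w ≠ 0) : IsProjLine (intLine w) := by
  have hne : intFunctional w ≠ 0 := by
    intro h
    have h0 := intFunctional_apply w w
    rw [h, LinearMap.zero_apply, eq_comm, Int.cast_eq_zero] at h0
    exact hw (dotProduct_self_eq_zero.mp h0)
  have h := Module.Dual.finrank_ker_add_one_of_ne_zero hne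
  rw [Module.finrank_fin_fun] at h
  exact Nat.succ_injective h

lemma incCount_eq_sum_pointDeg (P L : Finset (Submodule ℝ (Fin 3 → ℝ))) :
    incCount P L = ∑ p ∈ P, pointDeg L p := by
  simp only [incCount, pointDeg, Finset.card_filter, Finset.sum_product]

section Families

variable {ι κ : Type*} (v : ι → Fin 3 → ℤ) (w : κ → Fin 3 → ℤ)

lemma injective_intPoint_comp (h : ∀ i j, (∀ k, w k ⬝ᵥ v i = 0 ↔ w k ⬝ᵥ v j = 0) → i = j) :
    Function.Injective fun i => intPoint (v i) := by
  intro i j hij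
  refine h i j fun k => ?_
  rw [← intPoint_le_intLine_iff, ← intPoint_le_intLine_iff]
  exact iff_of_eq (congrArg (· ≤ intLine (w k)) hij)

lemma injective_intLine_comp (h : ∀ i j, (∀ k, w i ⬝ᵥ v k = 0 ↔ w j ⬝ᵥ v k = 0) → i = j) :
    Function.Injective fun i => intLine (w i) := by
  intro i j hij
  refine h i j fun k => ?_
  rw [← intPoint_le_intLine_iff, ← intPoint_le_intLine_iff]
  exact iff_of_eq (congrArg (intPoint (v k) ≤ ·) hij)

lemma pointDeg_image_intLine [Fintype κ] (hw : Function.Injective fun i => intLine (w i))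
    (x : Fin 3 → ℤ) :
    pointDeg (Finset.univ.image fun i => intLine (w i)) (intPoint x) =
      Fintype.card {i // w i ⬝ᵥ x = 0} := by
  rw [pointDeg, Finset.filter_image, Finset.card_image_of_injective _ hw, Fintype.card_subtype]
  simp only [intPoint_le_intLine_iff]

lemma lineDeg_image_intPoint [Fintype ι] (hv : Function.Injective fun i => intPoint (v i))
    (y : Fin 3 → ℤ) :
    lineDeg (Finset.univ.image fun i => intPoint (v i)) (intLine y) =
      Fintype.card {i // y ⬝ᵥ v i = 0} := by
  rw [lineDeg, Finset.filter_image, Finset.card_image_of_injective _ hv, Fintype.card_subtype]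
  simp only [intPoint_le_intLine_iff]

end Families

/-- Homogeneous coordinates of the sixteen points. -/
def configPoints : Fin 16 → Fin 3 → ℤ :=
  ![![2, -1, -2], ![2, -1, 0], ![0, 1, 2], ![0, 0, 1],
    ![1, 1, 1], ![1, 1, 0], ![2, 1, -1], ![0, 1, -1],
    ![1, 0, -1], ![2, -1, -1], ![1, 0, 0], ![2, 0, -1],
    ![2, 1, -2], ![2, 1, 0], ![0, 1, 1], ![1, 1, -1]]

/-- Homogeneous coordinates of the sixteen lines. -/
def configLines : Fin 16 → Fin 3 → ℤ :=
  ![![1, 1, 1], ![1, -1, 1], ![1, 0, 2], ![0, 0, 1],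
    ![1, 2, 2], ![1, 0, 1], ![2, -2, 1], ![1, -1, 0],
    ![0, 1, -1], ![0, 1, 1], ![1, 2, 0], ![0, 2, -1],
    ![1, -2, 1], ![1, 0, 0], ![1, -2, 2], ![1, -2, 0]]

theorem stmt15 :
    ∃ P L : Finset (Submodule ℝ (Fin 3 → ℝ)),
      (∀ p ∈ P, IsProjPoint p) ∧ (∀ l ∈ L, IsProjLine l) ∧
      P.card = 16 ∧ L.card = 16 ∧
      (∀ p ∈ P, pointDeg L p = 3 ∨ pointDeg L p = 4) ∧
      (∀ l ∈ L, lineDeg P l = 3 ∨ lineDeg P l = 4) ∧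
      incCount P L = 60 := by
  have hP : Function.Injective fun i => intPoint (configPoints i) :=
    injective_intPoint_comp configPoints configLines (by decide +kernel)
  have hL : Function.Injective fun i => intLine (configLines i) :=
    injective_intLine_comp configPoints configLines (by decide +kernel)
  refine ⟨Finset.univ.image fun i => intPoint (configPoints i),
    Finset.univ.image fun i => intLine (configLines i), ?_, ?_, ?_, ?_, ?_, ?_, ?_⟩
  · have h : ∀ i, configPoints i ≠ 0 := by decide +kernel
    simpa using fun i => isProjPoint_intPoint (h i)
  · have h : ∀ i, configLines i ≠ 0 := by decide +kernel
    simpa using fun i => isProjLine_intLine (h i)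
  · rw [Finset.card_image_of_injective _ hP, Finset.card_fin]
  · rw [Finset.card_image_of_injective _ hL, Finset.card_fin]
  · simp only [Finset.forall_mem_image, pointDeg_image_intLine _ hL]
    have h : ∀ i, Fintype.card {j // configLines j ⬝ᵥ configPoints i = 0} = 3 ∨
        Fintype.card {j // configLines j ⬝ᵥ configPoints i = 0} = 4 := by decide +kernel
    intro i _
    convert h i
  · simp only [Finset.forall_mem_image, lineDeg_image_intPoint _ hP]
    have h : ∀ j, Fintype.card {i // configLines j ⬝ᵥ configPoints i = 0} = 3 ∨
        Fintype.card {i // configLines j ⬝ᵥ configPoints i = 0} = 4 := by decide +kernel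
    intro j _
    convert h j
  · rw [incCount_eq_sum_pointDeg, Finset.sum_image hP.injOn]
    simp only [pointDeg_image_intLine _ hL]
    have h : ∑ i, Fintype.card {j // configLines j ⬝ᵥ configPoints i = 0} = 60 := by
      decide +kernel
    convert h
end
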